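/- Let 1 → A →α B →β C → 1 be a central extension of Γ-groups, U a cover of a left Γ-set X, φ ∈ K^1_Γ(U,X,C) a 1-cocycle ((δ_1φ)^{−1}(δ_2φ)(δ_0φ) = 1), and suppose ψ₀ ∈ K^1_Γ(U,X,B) satisfies β ∘ ψ₀ = φ and (δ_1ψ₀)^{−1}(δ_2ψ₀)(δ_0ψ₀) = 1. Then: (i) for every λ ∈ K^1_Γ(U,X,A) with ∂λ = 0, the cochain ψ₀·(α∘λ) also satisfies β∘(ψ₀·(α∘λ)) = φ and the 1-cocycle condition; (ii) every ψ ∈ K^1_Γ(U,X,B) with β∘ψ = φ satisfying the 1-cocycle condition equals ψ₀·(α∘λ) for a unique λ ∈ K^1_Γ(U,X,A) with ∂λ = 0; (iii) two such lifts ψ₀·(α∘λ) and ψ₀·(α∘λ′) are equivalent as liftings — i.e. there exists μ ∈ K^0_Γ(U,X,B) with β∘μ = 1 and (δ_1μ)·ψ₀·(α∘λ) = ψ₀·(α∘λ′)·(δ_0μ) — if and only if λ′ − λ lies in the image of ∂ : K^0_Γ(U,X,A) → K^1_Γ(U,X,A). Hence the equivalence classes of liftings of φ are in bijection with H^1_Γ(U,X,A).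 -/

import Mathlib

namespace SemiDD

/-- Extend a finite tuple by `1` outside its range. -/
def ext {G : Type*} [One G] {n : ℕ} (f : Fin n → G) (m : ℕ) : G :=
  if h : m < n then f ⟨m, h⟩ else 1

/-- The face maps `d_i : X^{p+1} → X^p` of the simplicial space `X^• = {Γ^p × X}`. -/
def face {Γ X : Type*} [Group Γ] [MulAction Γ X] {p : ℕ} (i : ℕ)
    (z : (Fin (p + 1) → Γ) × X) : (Fin p → Γ) × X :=
  (fun k => if (k : ℕ) + 1 < i then ext z.1 (k : ℕ)
    else if (k : ℕ) + 1 = i then ext z.1 (k : ℕ) * ext z.1 ((k : ℕ) + 1)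
    else ext z.1 ((k : ℕ) + 1),
   if i = p + 1 then ext z.1 p • z.2 else z.2)

/-- The degeneracy maps `e_i : X^p → X^{p+1}` of the simplicial space. -/
def degen {Γ X : Type*} [One Γ] {p : ℕ} (i : ℕ)
    (z : (Fin p → Γ) × X) : (Fin (p + 1) → Γ) × X :=
  (fun k => if (k : ℕ) < i then ext z.1 (k : ℕ)
    else if (k : ℕ) = i then 1
    else ext z.1 ((k : ℕ) - 1), z.2)

/-- The simplicial twisting maps `θ_i^{x^p} : G → G`: `θ_0^{(γ_1,…,γ_p,x)} = θ_{γ_1}`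
and `θ_i = id` for `i ≥ 1`. -/
def twist {Γ G : Type*} [Group Γ] [Group G] [MulDistribMulAction Γ G]
    {X : Type*} {p : ℕ} (i : ℕ) (z : (Fin p → Γ) × X) (g : G) : G :=
  if i = 0 then ext z.1 0 • g else g

/-- The point `x^p_i = γ_{i+1}⋯γ_p • x` associated to `x^p = (γ_1,…,γ_p,x) ∈ X^p`. -/
def pt {Γ X : Type*} [Group Γ] [MulAction Γ X] {p : ℕ}
    (z : (Fin p → Γ) × X) (i : ℕ) : X :=
  (((List.range p).drop i).map (ext z.1)).prod • z.2

/-- The subset `U_{(a_0,…,a_p)} ⊆ X^p` of the simplicial cover. -/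
def tupSet {Γ X ι : Type*} [Group Γ] [MulAction Γ X] (U : ι → Set X)
    {p : ℕ} (a : Fin (p + 1) → ι) : Set ((Fin p → Γ) × X) :=
  {z | ∀ i : Fin (p + 1), pt z (i : ℕ) ∈ U (a i)}

/-- The face map on index tuples: delete the `i`-th entry. -/
def faceIdx {ι : Type*} {n : ℕ} (i : ℕ) (a : Fin (n + 1) → ι) : Fin n → ι :=
  fun k => if (k : ℕ) < i then a k.castSucc else a k.succ

/-- The group `K^p_Γ(U,X,(G,θ))` of `p`-cochains. -/
abbrev K (Γ : Type*) {X ι : Type*} [Group Γ] [MulAction Γ X]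
    (U : ι → Set X) (G : Type*) [Group G] (p : ℕ) :=
  ∀ a : Fin (p + 1) → ι, tupSet (Γ := Γ) U a → G

open Classical in
/-- The twisted pullback maps `δ_i : K^p → K^{p+1}`. -/
noncomputable def tpb {Γ X ι G : Type*} [Group Γ] [MulAction Γ X] [Group G]
    [MulDistribMulAction Γ G] {U : ι → Set X} {p : ℕ} (i : ℕ)
    (φ : K Γ U G p) : K Γ U G (p + 1) :=
  fun a z =>
    twist i z.1
      (if h : face i z.1 ∈ tupSet (Γ := Γ) U (faceIdx i a) then
        φ (faceIdx i a) ⟨face i z.1, h⟩ else 1)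

/-- The coboundary `∂ = Σ_{i=0}^{p+1} (−1)^i δ_i : K^p → K^{p+1}` (written
multiplicatively, as an ordered product; for abelian coefficients this is the
alternating sum of the twisted pullbacks). -/
noncomputable def cob {Γ X ι G : Type*} [Group Γ] [MulAction Γ X] [Group G]
    [MulDistribMulAction Γ G] {U : ι → Set X} {p : ℕ}
    (φ : K Γ U G p) : K Γ U G (p + 1) :=
  ((List.range (p + 2)).map (fun i => tpb i φ ^ ((-1 : ℤ) ^ i))).prod

/-- The map on cochains induced by a map of coefficient groups. -/
def mapK {Γ X ι : Type*} [Group Γ] [MulAction Γ X] {U : ι → Set X}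
    {A B : Type*} [Group A] [Group B] (f : A → B) {p : ℕ}
    (φ : K Γ U A p) : K Γ U B p :=
  fun a z => f (φ a z)

/-- The restriction map on cochains induced by a refinement `r` of covers. -/
def res {Γ X ι κ G : Type*} [Group Γ] [MulAction Γ X] [Group G]
    {U : ι → Set X} {V : κ → Set X} (r : κ → ι)
    (hr : ∀ b, V b ⊆ U (r b)) {p : ℕ} (φ : K Γ U G p) : K Γ V G p :=
  fun b z => φ (fun i => r (b i)) ⟨z.1, fun i => hr (b i) (z.2 i)⟩

/-- A `Γ`-semi-equivariant (G,θ)-valued transition cocycle over the cover `U`. -/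
def IsCocycle {Γ X G ι : Type*} [Group Γ] [MulAction Γ X] [Group G]
    [MulDistribMulAction Γ G] (U : ι → Set X) (φ : ι → ι → Γ → X → G) : Prop :=
  (∀ (a : ι) (x : X), x ∈ U a → φ a a 1 x = 1) ∧
  (∀ (γ' γ : Γ) (a b c : ι) (x : X), x ∈ U a → γ • x ∈ U b →
    (γ' * γ) • x ∈ U c →
    φ c a (γ' * γ) x = φ c b γ' (γ • x) * γ' • φ b a γ x)

/-- Set-theoretic data of a `Γ`-semi-equivariant principal `(G,θ)`-bundle over
a left `Γ`-set `X`. -/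
structure SEBundle (Γ X G : Type*) [Group Γ] [MulAction Γ X] [Group G]
    [MulDistribMulAction Γ G] where
  P : Type*
  π : P → X
  surj : Function.Surjective π
  actG : P → G → P
  actG_one : ∀ p, actG p 1 = p
  actG_mul : ∀ p g g', actG (actG p g) g' = actG p (g * g')
  π_actG : ∀ p g, π (actG p g) = π p
  freeTrans : ∀ p q, π p = π q → ∃! g, actG p g = q
  actΓ : Γ → P → P
  actΓ_one : ∀ p, actΓ 1 p = p
  actΓ_mul : ∀ γ' γ p, actΓ γ' (actΓ γ p) = actΓ (γ' * γ) p
  π_actΓ : ∀ γ p, π (actΓ γ p) = γ • π p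
  semi : ∀ γ p g, actΓ γ (actG p g) = actG (actΓ γ p) (γ • g)

/-- The total space `⨆_{a} {a} × U_a × G` used in reconstructing a bundle
from a transition cocycle. -/
def Tot {X ι : Type*} (U : ι → Set X) (G : Type*) :=
  Σ a : ι, (U a) × G

/-- The gluing relation `(a,x,g) ~ (b,x,φ_{ba}(1,x)·g)`. -/
def rel {Γ X G ι : Type*} [One Γ] [Mul G] (U : ι → Set X)
    (φ : ι → ι → Γ → X → G) (z w : Tot U G) : Prop :=
  (z.2.1 : X) = (w.2.1 : X) ∧ w.2.2 = φ w.1 z.1 (1 : Γ) (z.2.1 : X) * z.2.2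

/-- The total space `P^φ` of the bundle reconstructed from a transition
cocycle `φ`. -/
def PB {Γ X G ι : Type*} [One Γ] [Mul G] (U : ι → Set X)
    (φ : ι → ι → Γ → X → G) :=
  Quot (rel U φ)

/-- The projection `π : P^φ → X`, `[a,x,g] ↦ x`. -/
def pbProj {Γ X G ι : Type*} [One Γ] [Mul G] {U : ι → Set X}
    {φ : ι → ι → Γ → X → G} : PB U φ → X :=
  Quot.lift (fun z => (z.2.1 : X)) (fun _ _ h => h.1)

/-- The right `G`-action on `P^φ`, `[a,x,g]·g' = [a,x,g·g']`. -/
def pbActG {Γ X G ι : Type*} [One Γ] [Group G] {U : ι → Set X}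
    {φ : ι → ι → Γ → X → G} (g' : G) : PB U φ → PB U φ :=
  Quot.lift (fun z => Quot.mk (rel U φ) ⟨z.1, ⟨z.2.1, z.2.2 * g'⟩⟩)
    (fun z w h => Quot.sound
      ⟨h.1, show w.2.2 * g' = φ w.1 z.1 (1 : Γ) (z.2.1 : X) * (z.2.2 * g') from
        by rw [h.2, mul_assoc]⟩)

/-- Specification of the left `Γ`-action `γ·[a,x,g] = [b, γ·x, φ_{ba}(γ,x)·(γ·g)]`
on `P^φ`. -/
def pbActSpec {Γ X G ι : Type*} [Group Γ] [MulAction Γ X] [Group G]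
    [MulDistribMulAction Γ G] (U : ι → Set X) (φ : ι → ι → Γ → X → G)
    (act : Γ → PB U φ → PB U φ) : Prop :=
  ∀ (γ : Γ) (a : ι) (x : X) (hx : x ∈ U a) (g : G) (b : ι) (hb : γ • x ∈ U b),
    act γ (Quot.mk (rel U φ) ⟨a, ⟨⟨x, hx⟩, g⟩⟩) =
      Quot.mk (rel U φ) ⟨b, ⟨⟨γ • x, hb⟩, φ b a γ x * γ • g⟩⟩

/-- The twisted pullback is multiplicative. -/
theorem tpb_mul {Γ X ι G : Type*} [Group Γ] [MulAction Γ X] [Group G]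
    [MulDistribMulAction Γ G] {U : ι → Set X} {p : ℕ} (i : ℕ) (φ ψ : K Γ U G p) :
    tpb i (φ * ψ) = tpb i φ * tpb i ψ := by
  funext a z
  simp only [tpb, twist, Pi.mul_apply]
  split_ifs <;> simp [smul_mul']

theorem tpb_inv {Γ X ι G : Type*} [Group Γ] [MulAction Γ X] [Group G]
    [MulDistribMulAction Γ G] {U : ι → Set X} {p : ℕ} (i : ℕ) (φ : K Γ U G p) :
    tpb i φ⁻¹ = (tpb i φ)⁻¹ :=
  map_inv (MonoidHom.mk' (tpb i) (tpb_mul i)) φ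

/-- The twisted pullback commutes with equivariant changes of coefficients. -/
theorem tpb_mapK {Γ X ι A B : Type*} [Group Γ] [MulAction Γ X] [Group A] [Group B]
    [MulDistribMulAction Γ A] [MulDistribMulAction Γ B] {U : ι → Set X} (f : A →* B)
    (hf : ∀ (γ : Γ) (g : A), f (γ • g) = γ • f g) {p : ℕ} (i : ℕ) (φ : K Γ U A p) :
    tpb i (mapK f φ) = mapK f (tpb i φ) := by
  funext a z
  simp only [tpb, twist, mapK]
  split_ifs <;> simp [hf]

theorem mapK_mul {Γ X ι A B : Type*} [Group Γ] [MulAction Γ X] [Group A] [Group B]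
    {U : ι → Set X} (f : A →* B) {p : ℕ} (φ ψ : K Γ U A p) :
    mapK f (φ * ψ) = mapK f φ * mapK f ψ := by
  funext a z
  simp [mapK]

theorem mapK_inv {Γ X ι A B : Type*} [Group Γ] [MulAction Γ X] [Group A] [Group B]
    {U : ι → Set X} (f : A →* B) {p : ℕ} (φ : K Γ U A p) :
    mapK f φ⁻¹ = (mapK f φ)⁻¹ := by
  funext a z
  simp [mapK]

theorem mapK_injective {Γ X ι A B : Type*} [Group Γ] [MulAction Γ X] [Group A] [Group B]
    {U : ι → Set X} {f : A → B} (hf : Function.Injective f) {p : ℕ} :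
    Function.Injective (mapK (Γ := Γ) (U := U) f (p := p)) := fun _ _ h => by
  funext a z
  exact hf (congrFun (congrFun h a) z)

theorem commute_mapK {Γ X ι A B : Type*} [Group Γ] [MulAction Γ X] [Group A] [Group B]
    {U : ι → Set X} {f : A → B} (hf : ∀ (x : A) (b : B), f x * b = b * f x) {p : ℕ}
    (φ : K Γ U A p) (ψ : K Γ U B p) : Commute (mapK f φ) ψ := by
  funext a z
  exact hf _ _

/-- Exactness of the sequence of cochain groups at the middle term. -/
theorem mapK_eq_one_iff {Γ X ι A B C : Type*} [Group Γ] [MulAction Γ X] [Group A] [Group B]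
    [Group C] {U : ι → Set X} {f : A → B} {g : B → C}
    (hfg : ∀ b : B, g b = 1 ↔ b ∈ Set.range f) {p : ℕ} (ψ : K Γ U B p) :
    mapK g ψ = 1 ↔ ∃ φ : K Γ U A p, mapK f φ = ψ := by
  constructor
  · intro h
    choose φ hφ using fun a z => (hfg (ψ a z)).1 (congrFun (congrFun h a) z)
    exact ⟨φ, funext fun a => funext fun z => hφ a z⟩
  · rintro ⟨φ, rfl⟩
    funext a z
    exact (hfg _).2 ⟨_, rfl⟩

theorem cob_zero {Γ X ι A : Type*} [Group Γ] [MulAction Γ X] [CommGroup A]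
    [MulDistribMulAction Γ A] {U : ι → Set X} (η : K Γ U A 0) :
    cob η = tpb 0 η * (tpb 1 η)⁻¹ := by
  simp [cob, List.range_succ]

theorem cob_one {Γ X ι A : Type*} [Group Γ] [MulAction Γ X] [CommGroup A]
    [MulDistribMulAction Γ A] {U : ι → Set X} (lam : K Γ U A 1) :
    cob lam = (tpb 1 lam)⁻¹ * tpb 2 lam * tpb 0 lam := by
  simp only [cob, List.range_succ, List.range_zero, List.nil_append,
    List.map_cons, List.map_nil, List.cons_append, List.prod_cons, List.prod_nil]
  norm_num
  rw [mul_comm]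

/-- Multiplying a cochain by a central one changes its nonabelian coboundary by the coboundary
of the central cochain. -/
theorem coboundary_mul_mapK {Γ X ι A B : Type*} [Group Γ] [MulAction Γ X] [CommGroup A] [Group B]
    [MulDistribMulAction Γ A] [MulDistribMulAction Γ B] {U : ι → Set X} (α : A →* B)
    (hα : ∀ (γ : Γ) (g : A), α (γ • g) = γ • α g)
    (hcentral : ∀ (x : A) (b : B), α x * b = b * α x) (ψ : K Γ U B 1) (lam : K Γ U A 1) :
    (tpb 1 (ψ * mapK α lam))⁻¹ * tpb 2 (ψ * mapK α lam) * tpb 0 (ψ * mapK α lam) =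
      (tpb 1 ψ)⁻¹ * tpb 2 ψ * tpb 0 ψ * mapK α (cob lam) := by
  simp only [tpb_mul, tpb_mapK α hα, cob_one, mapK_mul, mapK_inv, mul_inv_rev]
  have h (x : K Γ U A 2) (y : K Γ U B 2) := (commute_mapK hcentral x y).eq
  rw [← mapK_inv, mul_assoc _ (tpb 1 ψ)⁻¹, h]
  simp only [mul_assoc]
  rw [← mul_assoc (mapK α (tpb 2 lam)), ← mapK_mul, ← mul_assoc (mapK α _) (tpb 0 ψ), h,
    mul_comm (tpb 2 lam), mapK_mul]
  simp only [mul_assoc]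

/-- when a cocycle lifting `ψ₀` of `φ` exists, the liftings of
`φ` are the cochains `ψ₀·(α∘λ)` for 1-cocycles `λ` with values in `A`, and two
liftings are equivalent iff the corresponding `λ`s differ by a coboundary;
hence the liftings are classified by `H¹(X,A)`. -/
theorem statement19 {Γ X ι A B C : Type*} [Group Γ] [MulAction Γ X]
    [CommGroup A] [Group B] [Group C] [MulDistribMulAction Γ A]
    [MulDistribMulAction Γ B] [MulDistribMulAction Γ C]
    (U : ι → Set X) (α : A →* B) (β : B →* C)
    (hαΓ : ∀ (γ : Γ) (g : A), α (γ • g) = γ • α g)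
    (hβΓ : ∀ (γ : Γ) (g : B), β (γ • g) = γ • β g)
    (hαinj : Function.Injective ⇑α)
    (hcentral : ∀ (x : A) (b : B), α x * b = b * α x)
    (hβsurj : Function.Surjective ⇑β)
    (hexact : ∀ b : B, β b = 1 ↔ b ∈ Set.range ⇑α)
    (φ : K Γ U C 1) (hφcoc : (tpb 1 φ)⁻¹ * tpb 2 φ * tpb 0 φ = 1)
    (ψ₀ : K Γ U B 1) (hψ₀ : mapK (⇑β) ψ₀ = φ)
    (hψ₀coc : (tpb 1 ψ₀)⁻¹ * tpb 2 ψ₀ * tpb 0 ψ₀ = 1) :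
    (∀ lam : K Γ U A 1, cob lam = 1 →
      mapK (⇑β) (ψ₀ * mapK (⇑α) lam) = φ ∧
      (tpb 1 (ψ₀ * mapK (⇑α) lam))⁻¹ * tpb 2 (ψ₀ * mapK (⇑α) lam) *
        tpb 0 (ψ₀ * mapK (⇑α) lam) = 1) ∧
    (∀ ψ : K Γ U B 1, mapK (⇑β) ψ = φ →
      (tpb 1 ψ)⁻¹ * tpb 2 ψ * tpb 0 ψ = 1 →
      ∃! lam : K Γ U A 1, cob lam = 1 ∧ ψ = ψ₀ * mapK (⇑α) lam) ∧
    (∀ lam lam' : K Γ U A 1, cob lam = 1 → cob lam' = 1 →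
      ((∃ μ : K Γ U B 0, mapK (⇑β) μ = 1 ∧
          tpb 1 μ * (ψ₀ * mapK (⇑α) lam) = (ψ₀ * mapK (⇑α) lam') * tpb 0 μ) ↔
        (∃ η : K Γ U A 0, lam' * lam⁻¹ = cob η))) := by
  have hβα {p : ℕ} (lam : K Γ U A p) : mapK β (mapK α lam) = 1 :=
    (mapK_eq_one_iff hexact _).2 ⟨lam, rfl⟩
  have hcoc := coboundary_mul_mapK α hαΓ hcentral ψ₀
  have hinj {p : ℕ} : Function.Injective (mapK (Γ := Γ) (U := U) α (p := p)) :=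
    mapK_injective hαinj
  have hone {p : ℕ} : mapK α (1 : K Γ U A p) = 1 := funext fun a => funext fun z => map_one α
  refine ⟨fun lam hlam => ⟨?_, ?_⟩, fun ψ hψ hψcoc => ?_, fun lam lam' _ _ => ?_⟩
  · rw [mapK_mul, hβα, mul_one, hψ₀]
  · rw [hcoc, hψ₀coc, hlam, hone, one_mul]
  · obtain ⟨lam, hlam⟩ := (mapK_eq_one_iff hexact (ψ₀⁻¹ * ψ)).1 (by
      rw [mapK_mul, mapK_inv, hψ₀, hψ, inv_mul_cancel])
    have hψeq : ψ = ψ₀ * mapK α lam := by rw [hlam, mul_inv_cancel_left]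
    refine ⟨lam, ⟨hinj ?_, hψeq⟩, fun lam' h => hinj ?_⟩
    · rw [hψeq, hcoc, hψ₀coc, one_mul] at hψcoc
      rw [hψcoc, hone]
    · exact mul_left_cancel (h.2.symm.trans hψeq)
  · have key (η : K Γ U A 0) :
        tpb 1 (mapK α η) * (ψ₀ * mapK α lam) = (ψ₀ * mapK α lam') * tpb 0 (mapK α η) ↔
          lam' * lam⁻¹ = cob η⁻¹ := by
      rw [tpb_mapK α hαΓ, tpb_mapK α hαΓ, (commute_mapK hcentral _ _).eq, mul_assoc, mul_assoc,
        mul_right_inj, ← mapK_mul, ← mapK_mul, hinj.eq_iff, cob_zero, tpb_inv, tpb_inv, inv_inv,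
        mul_inv_eq_iff_eq_mul, mul_assoc, eq_inv_mul_iff_mul_eq, mul_comm (tpb 0 η),
        mul_comm lam]
      exact eq_comm
    constructor
    · rintro ⟨μ, hμ, h⟩
      obtain ⟨η, rfl⟩ := (mapK_eq_one_iff hexact μ).1 hμ
      exact ⟨η⁻¹, (key η).1 h⟩
    · rintro ⟨η, h⟩
      exact ⟨mapK α η⁻¹, hβα _, (key η⁻¹).2 (by rwa [inv_inv])⟩

end SemiDD
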